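/- (Tractable upper bound on the structured quadratic assignment loss, Equation (8)) Let S be a real n×n matrix, S_A and S_B real symmetric n×n matrices, and σ_gt a permutation of {1,…,n}. Define the structured quadratic assignment loss L_QAP = Σ_i S[i, σ_gt(i)] − min over permutations σ of [Σ_i S[i, σ(i)] + Σ_{i,j} S_A[i,j]·S_B[σ(i), σ(j)]]. Then L_QAP ≤ L(S, σ_gt) − ⟨λ_A, λ_B⟩₋, where L(S, σ_gt) = Σ_i S[i, σ_gt(i)] − min over permutations σ of Σ_i S[i, σ(i)] is the structured linear assignment loss and ⟨λ_A, λ_B⟩₋ = min over permutations π of Σ_i λ_A(i)·λ_B(π(i)) is the minimum scalar product of the eigenvalue sequences of S_A and S_B. -/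

import Mathlib

open Finset Matrix in
/-- By Birkhoff's theorem, the bilinear form of a doubly stochastic matrix is bounded below by the
minimum scalar product. -/
theorem inf'_sum_mul_perm_le_of_mem_doublyStochastic {ι : Type*} [Fintype ι] [DecidableEq ι]
    (a b : ι → ℝ) {D : Matrix ι ι ℝ} (hD : D ∈ doublyStochastic ℝ ι) :
    univ.inf' univ_nonempty (fun π : Equiv.Perm ι => ∑ i, a i * b (π i)) ≤
      ∑ i, ∑ j, a i * b j * D i j := by
  obtain ⟨w, hw, hw1, rfl⟩ := exists_eq_sum_perm_of_mem_doublyStochastic hD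
  have key : ∑ i, ∑ j, a i * b j * (∑ π, w π • π.permMatrix ℝ) i j =
      ∑ π : Equiv.Perm ι, w π * ∑ i, a i * b (π i) := by
    simp_rw [Matrix.sum_apply, Matrix.smul_apply, mul_sum, smul_eq_mul]
    rw [sum_comm_cycle]
    refine sum_congr rfl fun π _ => sum_congr rfl fun i _ => ?_
    simp [Equiv.Perm.permMatrix, PEquiv.toMatrix_apply, mul_comm]
  rw [key]
  calc _ = ∑ π : Equiv.Perm ι, w π *
        univ.inf' univ_nonempty (fun π : Equiv.Perm ι => ∑ i, a i * b (π i)) := by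
        rw [← sum_mul, hw1, one_mul]
    _ ≤ _ := by
        gcongr with π
        · exact hw π
        · exact inf'_le _ (mem_univ π)

/-- The entrywise square of a real orthogonal matrix is doubly stochastic. -/
theorem Matrix.sq_mem_doublyStochastic_of_mem_orthogonalGroup {ι : Type*} [Fintype ι]
    [DecidableEq ι] {W : Matrix ι ι ℝ} (hW : W ∈ Matrix.orthogonalGroup ι ℝ) :
    Matrix.of (fun i j => W i j ^ 2) ∈ doublyStochastic ℝ ι := by
  rw [mem_doublyStochastic_iff_sum]
  refine ⟨fun i j => sq_nonneg _, fun i => ?_, fun j => ?_⟩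
  · have h := congrFun₂ ((Matrix.mem_orthogonalGroup_iff ι ℝ).mp hW) i i
    simpa [Matrix.mul_apply, Matrix.star_apply, sq] using h
  · have h := congrFun₂ ((Matrix.mem_orthogonalGroup_iff' ι ℝ).mp hW) j j
    simpa [Matrix.mul_apply, Matrix.star_apply, sq] using h

/-- Entrywise form of the spectral theorem for a real symmetric matrix. -/
theorem Matrix.IsHermitian.apply_eq_sum_eigenvalues {ι : Type*} [Fintype ι] [DecidableEq ι]
    {A : Matrix ι ι ℝ} (hA : A.IsHermitian) (i j : ι) :
    A i j = ∑ k, hA.eigenvalues k *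
      ((hA.eigenvectorUnitary : Matrix ι ι ℝ) i k * (hA.eigenvectorUnitary : Matrix ι ι ℝ) j k) := by
  conv_lhs => rw [hA.spectral_theorem, Unitary.conjStarAlgAut_apply]
  rw [Matrix.mul_apply]
  refine Finset.sum_congr rfl fun k _ => ?_
  rw [Matrix.mul_diagonal, Matrix.star_apply]
  simp only [Function.comp_apply, RCLike.ofReal_real_eq_id, id_eq, star_trivial]
  ring

open Finset in
/-- The quadratic assignment cost is bounded below by the minimum scalar product of the
eigenvalues. -/
theorem Matrix.IsHermitian.inf'_sum_eigenvalues_mul_le {ι : Type*} [Fintype ι] [DecidableEq ι]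
    {A B : Matrix ι ι ℝ} (hA : A.IsHermitian) (hB : B.IsHermitian) (σ : Equiv.Perm ι) :
    univ.inf' univ_nonempty
        (fun π : Equiv.Perm ι => ∑ i, hA.eigenvalues i * hB.eigenvalues (π i)) ≤
      ∑ i, ∑ j, A i j * B (σ i) (σ j) := by
  set U : Matrix ι ι ℝ := ↑hA.eigenvectorUnitary with hU
  set V : Matrix ι ι ℝ := ↑hB.eigenvectorUnitary with hV
  have hW : star U * (σ.permMatrix ℝ * V) ∈ Matrix.orthogonalGroup ι ℝ := by
    refine mul_mem (Unitary.star_mem hA.eigenvectorUnitary.2)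
      (mul_mem ?_ hB.eigenvectorUnitary.2)
    rw [Matrix.mem_orthogonalGroup_iff, Matrix.transpose_permMatrix, ← Matrix.permMatrix_mul]
    simp
  have hWapply (k l : ι) : (star U * (σ.permMatrix ℝ * V)) k l = ∑ i, U i k * V (σ i) l := by
    rw [Matrix.mul_apply]
    simp [Equiv.Perm.permMatrix, PEquiv.toMatrix_toPEquiv_mul, Matrix.star_apply]
  refine (inf'_sum_mul_perm_le_of_mem_doublyStochastic _ _
    (Matrix.sq_mem_doublyStochastic_of_mem_orthogonalGroup hW)).trans_eq ?_
  simp_rw [Matrix.of_apply, hWapply, hA.apply_eq_sum_eigenvalues, hB.apply_eq_sum_eigenvalues,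
    ← hU, ← hV, sq, sum_mul_sum, mul_sum]
  simp_rw [← Fintype.sum_prod_type']
  refine Fintype.sum_equiv
    ⟨fun x => (x.2.2.1, x.2.2.2, x.1, x.2.1), fun x => (x.2.2.1, x.2.2.2, x.1, x.2.1),
      fun _ => rfl, fun _ => rfl⟩ _ _ fun x => ?_
  dsimp only [Equiv.coe_fn_mk]
  ring

/-- Tractable upper bound on the structured quadratic assignment loss
(Equation (8)): `L_QAP ≤ L(S, σ_gt) − ⟨λ_A, λ_B⟩₋`. -/
theorem structured_qap_loss_upper_bound
    (n : ℕ) (S SA SB : Matrix (Fin n) (Fin n) ℝ)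
    (hA : SA.IsHermitian) (hB : SB.IsHermitian) (σgt : Equiv.Perm (Fin n)) :
    (∑ i, S i (σgt i)) -
      Finset.univ.inf' Finset.univ_nonempty
        (fun σ : Equiv.Perm (Fin n) =>
          (∑ i, S i (σ i)) + ∑ i, ∑ j, SA i j * SB (σ i) (σ j))
    ≤ ((∑ i, S i (σgt i)) -
        Finset.univ.inf' Finset.univ_nonempty
          (fun σ : Equiv.Perm (Fin n) => ∑ i, S i (σ i)))
      - Finset.univ.inf' Finset.univ_nonempty
          (fun π : Equiv.Perm (Fin n) =>
            ∑ i, hA.eigenvalues i * hB.eigenvalues (π i)) := by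
  rw [sub_sub]
  refine sub_le_sub_left (Finset.le_inf' _ _ fun σ _ => ?_) _
  exact add_le_add (Finset.inf'_le _ (Finset.mem_univ σ)) (hA.inf'_sum_eigenvalues_mul_le hB σ)
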